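/- arXiv:2102.11429 — 2 statements merged into one kernel-verified Lean document; each statement's English description precedes it below -/
import Mathlib

section
/- (Proposition 1, functional characterization of full bayesian updating via conditional certainty equivalents.) Let S be a nonempty finite set, let C ⊆ Δ(S) be a nonempty compact convex set of priors, let A ⊆ S satisfy π(A) > 0 for every π ∈ C, and let D ⊆ Δ(S) be a nonempty compact convex set of priors with ν(A) = 1 for every ν ∈ D. Then D = BU(C,A) if and only if for every a : S → ℝ and every c ∈ ℝ, the equality min over π ∈ C of ( ∑_{s∈A} a(s)π(s) + c·π(S∖A) ) = c holds if and only if min over ν ∈ D of E_ν[a] = c. -/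
open Finset

noncomputable section

/-- The set of priors (probability distributions) on a finite state space `S`. -/
def simplex (S : Type*) [Fintype S] : Set (S → ℝ) :=
  {π | (∀ s, 0 ≤ π s) ∧ ∑ s, π s = 1}

variable {S : Type*} [Fintype S] [DecidableEq S]

/-- The probability of an event `A` under the prior `π`: `π(A) = ∑_{s ∈ A} π s`. -/
def pr (π : S → ℝ) (A : Finset S) : ℝ := ∑ s ∈ A, π s

/-- The Bayesian update `π_A` of a prior `π` given event `A`. -/
def bayes (π : S → ℝ) (A : Finset S) : S → ℝ :=
  fun s => if s ∈ A then π s / pr π A else 0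

/-- Full bayesian posterior set: prior-by-prior Bayesian updating. -/
def BU (C : Set (S → ℝ)) (A : Finset S) : Set (S → ℝ) :=
  (fun π => bayes π A) '' C

/-- `sup_{μ ∈ C} μ(A)`. -/
def maxPr (C : Set (S → ℝ)) (A : Finset S) : ℝ :=
  sSup ((fun μ => pr μ A) '' C)

/-- Partial bayesian posterior set with inference threshold `ρ`:
Bayesian updates of the priors `π ∈ C` with `π(A) ≥ ρ · sup_{μ ∈ C} μ(A)`. -/
def PB (C : Set (S → ℝ)) (A : Finset S) (ρ : ℝ) : Set (S → ℝ) :=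
  (fun π => bayes π A) '' {π ∈ C | ρ * maxPr C A ≤ pr π A}

/-- Expected value of `a : S → ℝ` under the prior `ν`. -/
def expv (a : S → ℝ) (ν : S → ℝ) : ℝ := ∑ s, a s * ν s

theorem continuous_pr {T : Type*} (A : Finset T) : Continuous fun π : T → ℝ => pr π A := by
  unfold pr
  fun_prop

theorem continuous_expv {T : Type*} [Fintype T] (a : T → ℝ) : Continuous (expv a) := by
  unfold expv
  fun_prop

theorem pr_compl_of_mem_simplex {π : S → ℝ} (hπ : π ∈ simplex S) (A : Finset S) :
    pr π Aᶜ = 1 - pr π A := by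
  have h : pr π A + pr π Aᶜ = ∑ s, π s := Finset.sum_add_sum_compl A π
  linarith [hπ.2]

theorem expv_bayes (a π : S → ℝ) (A : Finset S) :
    expv a (bayes π A) = (∑ s ∈ A, a s * π s) / pr π A := by
  simp only [expv, bayes, mul_ite, mul_zero, Finset.sum_ite_mem, Finset.univ_inter,
    Finset.sum_div, mul_div_assoc]

theorem isCompact_BU {T : Type*} [DecidableEq T] {C : Set (T → ℝ)} (hC : IsCompact C)
    {A : Finset T} (hA : ∀ π ∈ C, 0 < pr π A) : IsCompact (BU C A) := by
  refine hC.image_of_continuousOn (continuousOn_pi.2 fun s => ?_)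
  by_cases hs : s ∈ A
  · simp only [bayes, hs, if_true]
    exact (continuous_apply s).continuousOn.div (continuous_pr A).continuousOn
      fun π hπ => (hA π hπ).ne'
  · simp only [bayes, hs, if_false]
    exact continuousOn_const

theorem convex_BU {T : Type*} [DecidableEq T] {C : Set (T → ℝ)} (hC : Convex ℝ C)
    {A : Finset T} (hA : ∀ π ∈ C, 0 < pr π A) : Convex ℝ (BU C A) := by
  rintro _ ⟨π, hπ, rfl⟩ _ ⟨ρ, hρ, rfl⟩ u v hu hv huv
  have hp := hA π hπ
  have hq := hA ρ hρ
  set p := pr π A with hp_def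
  set q := pr ρ A with hq_def
  have hw : 0 < u / p + v / q := by
    rcases hu.eq_or_lt with rfl | hu
    · have : v = 1 := by linarith
      subst this
      positivity
    · positivity
  set w := u / p + v / q with hw_def
  refine ⟨(u / p / w) • π + (v / q / w) • ρ,
    hC hπ hρ (by positivity) (by positivity) (by rw [← add_div, div_self hw.ne']), ?_⟩
  have hpr : pr ((u / p / w) • π + (v / q / w) • ρ) A = 1 / w := by
    have : pr ((u / p / w) • π + (v / q / w) • ρ) A = u / p / w * p + v / q / w * q := by
      simp [hp_def, hq_def, pr, Finset.sum_add_distrib, Finset.mul_sum]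
    rw [this, ← huv]
    field_simp
  funext s
  by_cases hs : s ∈ A
  · simp only [bayes, hs, if_true, hpr, Pi.add_apply, Pi.smul_apply, smul_eq_mul,
      ← hp_def, ← hq_def]
    field_simp
  · simp [bayes, hs]

/-- The infimum of a continuous function on a nonempty compact set is characterized as
an attained lower bound. -/
theorem sInf_image_eq_iff {X : Type*} [TopologicalSpace X] {K : Set X} (hK : IsCompact K) (hne : K.Nonempty)
    {f : X → ℝ} (hf : Continuous f) (c : ℝ) :
    sInf (f '' K) = c ↔ (∀ x ∈ K, c ≤ f x) ∧ ∃ x ∈ K, f x = c := by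
  have hleast := (hK.image hf).isLeast_sInf (hne.image f)
  constructor
  · rintro rfl
    exact ⟨fun x hx => hleast.2 ⟨x, hx, rfl⟩, hleast.1⟩
  · rintro ⟨hle, hmem⟩
    refine hleast.unique ⟨hmem, ?_⟩
    rintro _ ⟨x, hx, rfl⟩
    exact hle x hx

/-- The conditional certainty equivalent of `a` given `A` is its lower expectation over
the full bayesian posterior set. -/
theorem sInf_conditional_eq_iff {C : Set (S → ℝ)} (hCsub : C ⊆ simplex S)
    (hCne : C.Nonempty) (hCcomp : IsCompact C) {A : Finset S} (hA : ∀ π ∈ C, 0 < pr π A)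
    (a : S → ℝ) (c : ℝ) :
    sInf ((fun π => (∑ s ∈ A, a s * π s) + c * pr π Aᶜ) '' C) = c ↔
      sInf (expv a '' BU C A) = c := by
  have hcont : Continuous fun π : S → ℝ => (∑ s ∈ A, a s * π s) + c * pr π Aᶜ := by
    have := continuous_pr Aᶜ
    fun_prop
  rw [sInf_image_eq_iff hCcomp hCne hcont,
    sInf_image_eq_iff (isCompact_BU hCcomp hA) (hCne.image _) (continuous_expv a)]
  simp only [BU, Set.forall_mem_image, Set.exists_mem_image, expv_bayes]
  refine and_congr (forall₂_congr fun π hπ => ?_)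
    (exists_congr fun π => and_congr_right fun hπ => ?_)
  · rw [pr_compl_of_mem_simplex (hCsub hπ), le_div_iff₀ (hA π hπ)]
    constructor <;> intro h <;> linarith
  · rw [pr_compl_of_mem_simplex (hCsub hπ), div_eq_iff (hA π hπ).ne']
    constructor <;> intro h <;> linarith

theorem subset_of_sInf_expv_le {K L : Set (S → ℝ)} (hK : IsCompact K) (hKne : K.Nonempty)
    (hKconv : Convex ℝ K) (hL : IsCompact L)
    (h : ∀ a : S → ℝ, sInf (expv a '' K) ≤ sInf (expv a '' L)) : L ⊆ K := by
  intro x hx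
  by_contra hxK
  obtain ⟨f, u, hfx, hfK⟩ := geometric_hahn_banach_point_closed hKconv hK.isClosed hxK
  have hf : ∀ y, expv (fun s => f (Pi.single s 1)) y = f y := fun y => by
    conv_rhs => rw [pi_eq_sum_univ' y, map_sum]
    refine Finset.sum_congr rfl fun s _ => ?_
    rw [map_smul, smul_eq_mul, mul_comm]
  have hK' := le_csInf (hKne.image (expv fun s => f (Pi.single s 1))) (a := u) (by
    rintro _ ⟨y, hy, rfl⟩
    rw [hf]
    exact (hfK y hy).le)
  have hL' := csInf_le (hL.image (continuous_expv fun s => f (Pi.single s 1))).bddBelow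
    ⟨x, hx, rfl⟩
  rw [hf] at hL'
  linarith [h fun s => f (Pi.single s 1)]

theorem stmt11 {S : Type*} [Fintype S] [DecidableEq S] [Nonempty S]
    (C : Set (S → ℝ)) (hCsub : C ⊆ simplex S) (hCne : C.Nonempty) (hCcomp : IsCompact C)
    (hCconv : Convex ℝ C)
    (A : Finset S) (hA : ∀ π ∈ C, 0 < pr π A)
    (D : Set (S → ℝ)) (hDsub : D ⊆ simplex S) (hDne : D.Nonempty) (hDcomp : IsCompact D)
    (hDconv : Convex ℝ D) (hDA : ∀ ν ∈ D, pr ν A = 1) :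
    D = BU C A ↔
      ∀ (a : S → ℝ) (c : ℝ),
        (sInf ((fun π => (∑ s ∈ A, a s * π s) + c * pr π Aᶜ) '' C) = c ↔
          sInf (expv a '' D) = c) := by
  have hBU := isCompact_BU hCcomp hA
  have hBUne : (BU C A).Nonempty := hCne.image _
  simp only [sInf_conditional_eq_iff hCsub hCne hCcomp hA]
  constructor
  · rintro rfl a c
    rfl
  · intro h
    have heq : ∀ a : S → ℝ, sInf (expv a '' D) = sInf (expv a '' BU C A) :=
      fun a => (h a _).1 rfl
    exact Set.Subset.antisymm
      (subset_of_sInf_expv_le hBU hBUne (convex_BU hCconv hA) hDcomp fun a => (heq a).ge)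
      (subset_of_sInf_expv_le hDcomp hDne hDconv hBU fun a => (heq a).le)
end
end

section
/- (PB violates dynamic consistency.) There exist a nonempty finite set S, a nonempty compact convex set of priors C ⊆ Δ(S), a set A ⊆ S with π(A) > 0 for every π ∈ C, a threshold ρ ∈ (0,1), and functions a, b : S → ℝ with a(s) = b(s) for all s ∈ S∖A, such that the ex-ante maxmin ranking and the conditional maxmin ranking are reversed: min over π ∈ C of E_π[a] > min over π ∈ C of E_π[b], yet min over ν ∈ C^ρ_A of E_ν[b] > min over ν ∈ C^ρ_A of E_ν[a]. -/
open Finset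

noncomputable section

variable {S : Type*} [Fintype S] [DecidableEq S]

/-- The priors on three states that give the first state probability `1 / 2`. -/
def halfPriors : Set (Fin 3 → ℝ) := simplex (Fin 3) ∩ {π | π 0 = 1 / 2}

lemma mem_halfPriors_iff {π : Fin 3 → ℝ} :
    π ∈ halfPriors ↔ 0 ≤ π 1 ∧ 0 ≤ π 2 ∧ π 0 = 1 / 2 ∧ π 1 + π 2 = 1 / 2 := by
  simp only [halfPriors, simplex, Set.mem_inter_iff, Set.mem_ofPred_eq, Fin.forall_fin_succ,
    Fin.sum_univ_three]
  constructor
  · rintro ⟨⟨⟨-, h1, h2, -⟩, hs⟩, h0⟩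
    exact ⟨h1, h2, h0, by linarith⟩
  · rintro ⟨h1, h2, h0, hs⟩
    exact ⟨⟨⟨by linarith, h1, h2, fun i => i.elim0⟩, by linarith⟩, h0⟩

lemma isCompact_halfPriors : IsCompact halfPriors :=
  (isCompact_stdSimplex ℝ (Fin 3)).inter_right
    (isClosed_eq (continuous_apply 0) continuous_const)

lemma convex_halfPriors : Convex ℝ halfPriors :=
  (convex_stdSimplex ℝ (Fin 3)).inter
    (convex_hyperplane (LinearMap.proj (R := ℝ) (φ := fun _ : Fin 3 => ℝ) 0).isLinear (1 / 2))

lemma pr_zero_one (π : Fin 3 → ℝ) : pr π {0, 1} = π 0 + π 1 := by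
  simp [pr]

lemma halfPriors_pr_pos {π : Fin 3 → ℝ} (hπ : π ∈ halfPriors) : 0 < pr π {0, 1} := by
  rw [mem_halfPriors_iff] at hπ
  rw [pr_zero_one]
  linarith

lemma halfPriors_le_pr {π : Fin 3 → ℝ} (hπ : π ∈ halfPriors) :
    1 / 2 * maxPr halfPriors {0, 1} ≤ pr π {0, 1} := by
  have hmax : maxPr halfPriors {0, 1} ≤ 1 := by
    refine csSup_le (Set.Nonempty.image _ ⟨π, hπ⟩) ?_
    rintro _ ⟨μ, hμ, rfl⟩
    rw [mem_halfPriors_iff] at hμ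
    simp only [pr_zero_one]
    linarith
  rw [mem_halfPriors_iff] at hπ
  rw [pr_zero_one]
  linarith

lemma PB_halfPriors :
    PB halfPriors {0, 1} (1 / 2) = (fun π => bayes π {0, 1}) '' halfPriors := by
  unfold PB
  congr 1
  exact Set.sep_eq_self_iff_mem_true.2 fun _ => halfPriors_le_pr

lemma expv_bet (π : Fin 3 → ℝ) : expv ![4, 0, 0] π = 4 * π 0 := by
  simp [expv, Fin.sum_univ_three]

lemma expv_event (π : Fin 3 → ℝ) : expv ![3, 3, 0] π = 3 * (π 0 + π 1) := by
  simp [expv, Fin.sum_univ_three, mul_add]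

lemma bayes_zero (π : Fin 3 → ℝ) : bayes π {0, 1} 0 = π 0 / (π 0 + π 1) := by
  simp [bayes, pr_zero_one]

lemma bayes_one (π : Fin 3 → ℝ) : bayes π {0, 1} 1 = π 1 / (π 0 + π 1) := by
  simp [bayes, pr_zero_one]

lemma left_mem_halfPriors : ![1 / 2, 1 / 2, 0] ∈ halfPriors := by
  simp [mem_halfPriors_iff]

lemma right_mem_halfPriors : ![1 / 2, 0, 1 / 2] ∈ halfPriors := by
  simp [mem_halfPriors_iff]

lemma sInf_expv_event_lt :
    sInf (expv ![3, 3, 0] '' halfPriors) < sInf (expv ![4, 0, 0] '' halfPriors) := by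
  have hb : sInf (expv ![3, 3, 0] '' halfPriors) ≤ 3 / 2 := by
    refine csInf_le ⟨0, ?_⟩ ⟨_, right_mem_halfPriors, ?_⟩
    · rintro _ ⟨π, hπ, rfl⟩
      rw [mem_halfPriors_iff] at hπ
      rw [expv_event]
      linarith
    · rw [expv_event]
      norm_num
  have ha : 2 ≤ sInf (expv ![4, 0, 0] '' halfPriors) := by
    refine le_csInf (Set.Nonempty.image _ ⟨_, left_mem_halfPriors⟩) ?_
    rintro _ ⟨π, hπ, rfl⟩
    rw [mem_halfPriors_iff] at hπ
    rw [expv_bet]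
    linarith
  linarith

lemma sInf_expv_bet_PB_lt :
    sInf (expv ![4, 0, 0] '' PB halfPriors {0, 1} (1 / 2)) <
      sInf (expv ![3, 3, 0] '' PB halfPriors {0, 1} (1 / 2)) := by
  rw [PB_halfPriors]
  have ha : sInf (expv ![4, 0, 0] '' ((fun π => bayes π {0, 1}) '' halfPriors)) ≤ 2 := by
    refine csInf_le ⟨0, ?_⟩ ⟨_, ⟨_, left_mem_halfPriors, rfl⟩, ?_⟩
    · rintro _ ⟨_, ⟨π, hπ, rfl⟩, rfl⟩
      rw [mem_halfPriors_iff] at hπ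
      obtain ⟨h1, -, h0, -⟩ := hπ
      simp only [expv_bet, bayes_zero, h0]
      positivity
    · simp only [expv_bet, bayes_zero]
      norm_num
  have hb : 3 ≤ sInf (expv ![3, 3, 0] '' ((fun π => bayes π {0, 1}) '' halfPriors)) := by
    refine le_csInf (Set.Nonempty.image _ (Set.Nonempty.image _ ⟨_, left_mem_halfPriors⟩)) ?_
    rintro _ ⟨_, ⟨π, hπ, rfl⟩, rfl⟩
    have hpos := halfPriors_pr_pos hπ
    rw [pr_zero_one] at hpos
    simp only [expv_event, bayes_zero, bayes_one, ← add_div, div_self hpos.ne', mul_one, le_refl]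
  linarith

theorem stmt15 :
    ∃ (S : Type) (_ : Fintype S) (_ : DecidableEq S) (_ : Nonempty S)
      (C : Set (S → ℝ)) (A : Finset S) (ρ : ℝ) (a b : S → ℝ),
      C ⊆ simplex S ∧ C.Nonempty ∧ IsCompact C ∧ Convex ℝ C ∧
      (∀ π ∈ C, 0 < pr π A) ∧ ρ ∈ Set.Ioo (0 : ℝ) 1 ∧
      (∀ s ∉ A, a s = b s) ∧
      sInf (expv b '' C) < sInf (expv a '' C) ∧
      sInf (expv a '' PB C A ρ) < sInf (expv b '' PB C A ρ) := by
  refine ⟨Fin 3, inferInstance, inferInstance, inferInstance, halfPriors, {0, 1}, 1 / 2,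
    ![4, 0, 0], ![3, 3, 0], Set.inter_subset_left, ⟨_, left_mem_halfPriors⟩,
    isCompact_halfPriors, convex_halfPriors, fun _ => halfPriors_pr_pos, by norm_num, ?_,
    sInf_expv_event_lt, sInf_expv_bet_PB_lt⟩
  intro s hs
  fin_cases s <;> simp_all
end
end
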